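/- Let r be a polynomial in n variables over ℝ with total degree strictly less than 2k, let ε > 0, and let f(x) = r(x) + ε·(x₁² + ⋯ + xₙ²)^k. Then f(x) tends to +∞ as ‖x‖ → ∞ (i.e., the evaluation function of f tends to atTop along the cocompact filter on ℝⁿ), and consequently the zero set {x ∈ ℝⁿ | f(x) = 0} is compact. -/

import Mathlib

open MvPolynomial Filter

open Asymptotics

namespace MvPolynomial

lemma abs_eval_le_of_one_le {n : ℕ} (r : MvPolynomial (Fin n) ℝ) {v : Fin n → ℝ} {M : ℝ}
    (hM : 1 ≤ M) (hv : ∀ i, |v i| ≤ M) :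
    |eval v r| ≤ (∑ d ∈ r.support, |r.coeff d|) * M ^ r.totalDegree := by
  rw [eval_eq, Finset.sum_mul]
  refine (Finset.abs_sum_le_sum_abs _ _).trans (Finset.sum_le_sum fun d hd => ?_)
  rw [abs_mul, Finset.abs_prod]
  gcongr
  calc ∏ i ∈ d.support, |v i ^ d i| ≤ ∏ i ∈ d.support, M ^ d i := by
        refine Finset.prod_le_prod (fun _ _ => abs_nonneg _) fun i _ => ?_
        rw [abs_pow]
        exact pow_le_pow_left₀ (abs_nonneg _) (hv i) _
    _ = M ^ (d.sum fun _ e => e) := Finset.prod_pow_eq_pow_sum _ _ _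
    _ ≤ M ^ r.totalDegree := pow_le_pow_right₀ hM (le_totalDegree hd)

lemma isBigO_eval_cocompact {n : ℕ} (r : MvPolynomial (Fin n) ℝ) :
    (fun x : EuclideanSpace ℝ (Fin n) => eval (fun i => x i) r)
      =O[cocompact (EuclideanSpace ℝ (Fin n))] fun x => ‖x‖ ^ r.totalDegree := by
  refine IsBigO.of_bound (∑ d ∈ r.support, |r.coeff d|) ?_
  filter_upwards [(tendsto_norm_cocompact_atTop (E := EuclideanSpace ℝ (Fin n))).eventually_ge_atTop
    1] with x hx
  rw [Real.norm_eq_abs, norm_pow, norm_norm]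
  exact abs_eval_le_of_one_le r hx fun i => PiLp.norm_apply_le x i

lemma isLittleO_eval_cocompact {n m : ℕ} {r : MvPolynomial (Fin n) ℝ} (hr : r.totalDegree < m) :
    (fun x : EuclideanSpace ℝ (Fin n) => eval (fun i => x i) r)
      =o[cocompact (EuclideanSpace ℝ (Fin n))] fun x => ‖x‖ ^ m :=
  r.isBigO_eval_cocompact.trans_isLittleO <|
    (isLittleO_pow_pow_atTop_of_lt hr).comp_tendsto tendsto_norm_cocompact_atTop

end MvPolynomial

lemma isCompact_preimage_zero_of_tendsto_cocompact_atTop {E : Type*} [TopologicalSpace E]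
    {g : E → ℝ} (hg : Continuous g) (h : Tendsto g (cocompact E) atTop) :
    IsCompact {x | g x = 0} := by
  obtain ⟨t, ht, hsub⟩ := mem_cocompact.1 (h.eventually_gt_atTop 0)
  refine ht.of_isClosed_subset (isClosed_eq hg continuous_const) fun x hx => ?_
  by_contra hxt
  exact (hsub hxt : 0 < g x).ne' hx

/-- If `r` is a real polynomial in `n` variables of total degree `< 2k` and `ε > 0`,
then `f(x) = r(x) + ε(x₁² + ⋯ + xₙ²)^k` tends to `+∞` as `‖x‖ → ∞` (i.e. along the
cocompact filter on `ℝⁿ`), and consequently its zero set is compact. -/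
theorem proper_and_compact_zero_set_of_dominating_norm_power (n k : ℕ)
    (r : MvPolynomial (Fin n) ℝ) (hr : r.totalDegree < 2 * k) (ε : ℝ) (hε : 0 < ε)
    (f : MvPolynomial (Fin n) ℝ) (hf : f = r + C ε * (∑ i, X i ^ 2) ^ k) :
    Tendsto (fun x : EuclideanSpace ℝ (Fin n) => eval (fun i => x i) f)
        (cocompact (EuclideanSpace ℝ (Fin n))) atTop ∧
      IsCompact {x : EuclideanSpace ℝ (Fin n) | eval (fun i => x i) f = 0} := by
  have heval (x : EuclideanSpace ℝ (Fin n)) : eval (fun i => x i) f =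
      eval (fun i => x i) r + ε * ‖x‖ ^ (2 * k) := by
    simp [hf, pow_mul, EuclideanSpace.real_norm_sq_eq]
  have hdom : Tendsto (fun x : EuclideanSpace ℝ (Fin n) => ε * ‖x‖ ^ (2 * k))
      (cocompact _) atTop :=
    ((tendsto_pow_atTop (by omega)).comp tendsto_norm_cocompact_atTop).const_mul_atTop hε
  have hlim : Tendsto (fun x : EuclideanSpace ℝ (Fin n) => eval (fun i => x i) f)
      (cocompact _) atTop := by
    simp_rw [heval]
    have hr' := (isLittleO_eval_cocompact hr).const_mul_right hε.ne'
    exact (IsEquivalent.refl.add_isLittleO hr').symm.tendsto_atTop hdom |>.congr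
      fun x => add_comm _ _
  exact ⟨hlim, isCompact_preimage_zero_of_tendsto_cocompact_atTop
    ((MvPolynomial.continuous_eval f).comp (by fun_prop)) hlim⟩
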